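/- arXiv:2211.14973 — 2 statements merged into one kernel-verified Lean document; each statement's English description precedes it below -/
import Mathlib

section
/- For every integer n >= 13, no player has a winning strategy in the three-player Tribonacci game on n. -/
/-- The Tribonacci numbers: `T 1 = 1`, `T 2 = 2`, `T 3 = 4`,
`T (i+1) = T i + T (i-1) + T (i-2)` for `i ≥ 3`. -/
def trib : ℕ → ℕ
  | 0 => 0
  | 1 => 1
  | 2 => 2
  | 3 => 4
  | (i + 4) => trib (i + 3) + trib (i + 2) + trib (i + 1)

/-- A legal move of the Tribonacci game, as a relation between the position
before and the position after the move (positions are multisets of naturals). -/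
def TribMove (A B : Multiset ℕ) : Prop :=
  (∃ i, 3 ≤ i ∧ ({trib (i - 2), trib (i - 1), trib i} : Multiset ℕ) ≤ A ∧
      B = A - {trib (i - 2), trib (i - 1), trib i} + {trib (i + 1)}) ∨
  (({1, 1, 2} : Multiset ℕ) ≤ A ∧ B = A - {1, 1, 2} + {4}) ∨
  (({1, 1} : Multiset ℕ) ≤ A ∧ B = A - {1, 1} + {2}) ∨
  (({2, 2} : Multiset ℕ) ≤ A ∧ B = A - {2, 2} + {4}) ∨
  (({4, 4} : Multiset ℕ) ≤ A ∧ B = A - {4, 4} + {7, 1}) ∨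
  (∃ i, 3 < i ∧ ({trib i, trib i} : Multiset ℕ) ≤ A ∧
      B = A - {trib i, trib i} + {trib (i + 1), trib (i - 3)})

/-- A position is terminal when no legal move remains. -/
def Terminal (Move : Multiset ℕ → Multiset ℕ → Prop) (pos : Multiset ℕ) : Prop :=
  ∀ B, ¬ Move pos B

/-- `AllianceWins Move p team t pos`: in the `p`-player game with move relation `Move`,
where players `1, …, p` move cyclically (the mover of the `t`-th move, counting from `t = 0`,
is player `t % p + 1`) and the side making the last legal move wins, the alliance
(set of players) `team` can guarantee, from position `pos` with `t` moves already made,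
that one of its members makes the last move, no matter how the other players play. -/
inductive AllianceWins (Move : Multiset ℕ → Multiset ℕ → Prop) (p : ℕ) (team : ℕ → Prop) :
    ℕ → Multiset ℕ → Prop
  | endMove (t : ℕ) (pos B : Multiset ℕ) (hturn : team (t % p + 1)) (hmove : Move pos B)
      (hterm : Terminal Move B) : AllianceWins Move p team t pos
  | contMove (t : ℕ) (pos B : Multiset ℕ) (hturn : team (t % p + 1)) (hmove : Move pos B)
      (hwin : AllianceWins Move p team (t + 1) B) : AllianceWins Move p team t pos
  | oppMove (t : ℕ) (pos : Multiset ℕ) (hturn : ¬ team (t % p + 1))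
      (hex : ∃ B, Move pos B)
      (hall : ∀ B, Move pos B → AllianceWins Move p team (t + 1) B) :
      AllianceWins Move p team t pos

/-- Player `m` has a winning strategy in the `p`-player game on `n`
(played from `n` copies of `1`, with player 1 moving first). -/
def PlayerWins (Move : Multiset ℕ → Multiset ℕ → Prop) (p m n : ℕ) : Prop :=
  AllianceWins Move p (fun q => q = m) 0 (Multiset.replicate n 1)

theorem aw_not_terminal {M : Multiset ℕ → Multiset ℕ → Prop} {p : ℕ} {team : ℕ → Prop}
    {t : ℕ} {P : Multiset ℕ} (h : AllianceWins M p team t P) : ¬ Terminal M P := by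
  intro hT
  cases h with
  | endMove _ _ B hturn hmove hterm => exact hT _ hmove
  | contMove _ _ B hturn hmove hwin => exact hT _ hmove
  | oppMove _ _ hturn hex hall => exact hex.elim fun B hB => hT _ hB

/-- One player cannot force a win from the same position at two different phases. -/
theorem aw_disjoint {M : Multiset ℕ → Multiset ℕ → Prop} {m t : ℕ} {P : Multiset ℕ}
    (h : AllianceWins M 3 (fun q => q = m) t P) :
    ∀ s, t % 3 ≠ s % 3 → AllianceWins M 3 (fun q => q = m) s P → False := by
  induction h with
  | endMove t P B hturn hmove hterm =>
    intro s hs h2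
    cases h2 with
    | endMove _ _ B' hturn' hmove' hterm' => omega
    | contMove _ _ B' hturn' hmove' hwin' => omega
    | oppMove _ _ hturn' hex' hall' => exact aw_not_terminal (hall' _ hmove) hterm
  | contMove t P B hturn hmove hwin ih =>
    intro s hs h2
    cases h2 with
    | endMove _ _ B' hturn' hmove' hterm' => omega
    | contMove _ _ B' hturn' hmove' hwin' => omega
    | oppMove _ _ hturn' hex' hall' => exact ih (s + 1) (by omega) (hall' _ hmove)
  | oppMove t P hturn hex hall ih =>
    intro s hs h2
    cases h2 with
    | endMove _ _ B' hturn' hmove' hterm' => exact aw_not_terminal (hall _ hmove') hterm'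
    | contMove _ _ B' hturn' hmove' hwin' => exact ih _ hmove' (s + 1) (by omega) hwin'
    | oppMove _ _ hturn' hex' hall' =>
      obtain ⟨B, hB⟩ := hex
      exact ih _ hB (s + 1) (by omega) (hall' _ hB)

theorem aw_opp {m t : ℕ} {P B : Multiset ℕ}
    (h : AllianceWins TribMove 3 (fun q => q = m) t P) (ht : t % 3 + 1 ≠ m)
    (hB : TribMove P B) : AllianceWins TribMove 3 (fun q => q = m) (t + 1) B := by
  cases h with
  | endMove _ _ B' hturn' hmove' hterm' => exact absurd hturn' ht
  | contMove _ _ B' hturn' hmove' hwin' => exact absurd hturn' ht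
  | oppMove _ _ hturn' hex' hall' => exact hall' _ hB

theorem move11 (S : Multiset ℕ) : TribMove ({1, 1} + S) (S + {2}) :=
  Or.inr (Or.inr (Or.inl ⟨Multiset.le_add_right _ _, by rw [add_tsub_cancel_left]⟩))

theorem move22 (S : Multiset ℕ) : TribMove ({2, 2} + S) (S + {4}) :=
  Or.inr (Or.inr (Or.inr (Or.inl
    ⟨Multiset.le_add_right _ _, by rw [add_tsub_cancel_left]⟩)))

theorem move112 (S : Multiset ℕ) : TribMove ({1, 1, 2} + S) (S + {4}) :=
  Or.inr (Or.inl ⟨Multiset.le_add_right _ _, by rw [add_tsub_cancel_left]⟩)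

theorem move124 (S : Multiset ℕ) : TribMove ({1, 2, 4} + S) (S + {7}) :=
  Or.inl ⟨3, le_rfl, Multiset.le_add_right {1, 2, 4} S, by
    change _ = ({1, 2, 4} + S) - {1, 2, 4} + {7}
    rw [add_tsub_cancel_left]⟩

/-- Stealing: if both of the next two movers are opponents and `1,1,2` is available. -/
theorem steal {m t : ℕ} {S : Multiset ℕ}
    (h : AllianceWins TribMove 3 (fun q => q = m) t ({1, 1, 2} + S))
    (h0 : t % 3 + 1 ≠ m) (h1 : (t + 1) % 3 + 1 ≠ m) : False := by
  have a := aw_opp h h0 (move112 S)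
  have e : ({1, 1, 2} + S : Multiset ℕ) = {1, 1} + ({2} + S) := by
    rw [← add_assoc]; rfl
  have e2 : ({2} + S + {2} : Multiset ℕ) = {2, 2} + S := by
    rw [add_comm, ← add_assoc]; rfl
  rw [e] at h
  have b := aw_opp h h0 (move11 _)
  rw [e2] at b
  have c := aw_opp b h1 (move22 S)
  exact aw_disjoint a _ (by omega) c

theorem trib_ge : ∀ i, 2 ≤ i → 2 ≤ trib i
  | 0, h => by omega
  | 1, h => by omega
  | 2, _ => by simp [trib]
  | 3, _ => by simp [trib]
  | (i + 4), _ => by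
    have := trib_ge (i + 3) (by omega)
    simp only [trib]; omega

theorem small_le {k : ℕ} {S X : Multiset ℕ} (hS : S.card ≤ 1)
    (h : X ≤ Multiset.replicate k 1 + S) : (X.filter (fun x => x ≠ 1)).card ≤ 1 := by
  have h2 := Multiset.card_le_card (Multiset.filter_le_filter (fun x => x ≠ 1) h)
  have h3 : (Multiset.replicate k 1).filter (fun x : ℕ => x ≠ 1) = 0 := by
    rw [Multiset.filter_eq_nil]
    intro a ha; simp [Multiset.eq_of_mem_replicate ha]
  rw [Multiset.filter_add, h3, zero_add] at h2
  exact h2.trans ((Multiset.card_le_card (Multiset.filter_le _ _)).trans hS)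

theorem two_big {k a b : ℕ} {S : Multiset ℕ} (hS : S.card ≤ 1) (ha : 2 ≤ a) (hb : 2 ≤ b)
    (h : ({a, b} : Multiset ℕ) ≤ Multiset.replicate k 1 + S) : False := by
  have := small_le hS h
  have e : (({a, b} : Multiset ℕ).filter (fun x => x ≠ 1)) = {a, b} := by
    rw [Multiset.filter_eq_self]
    intro x hx
    simp only [Multiset.insert_eq_cons, Multiset.mem_cons, Multiset.mem_singleton] at hx
    omega
  rw [e] at this
  simp at this

theorem move_class {k : ℕ} {S B : Multiset ℕ} (hS : S.card ≤ 1)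
    (h : TribMove (Multiset.replicate (k + 2) 1 + S) B) :
    (2 ∈ S ∧ B = Multiset.replicate k 1 + (S.erase 2) + {4}) ∨
    B = Multiset.replicate k 1 + S + {2} := by
  have e : Multiset.replicate (k + 2) 1 + S = {1, 1} + (Multiset.replicate k 1 + S) := by
    rw [add_comm k 2, Multiset.replicate_add, add_assoc]; rfl
  rcases h with ⟨i, hi, hle, -⟩ | ⟨hle, hB⟩ | ⟨-, hB⟩ | ⟨hle, -⟩ | ⟨hle, -⟩ | ⟨i, hi, hle, -⟩
  · exfalso
    exact two_big hS (trib_ge (i - 1) (by omega)) (trib_ge i (by omega))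
      ((Multiset.le_cons_self _ _).trans hle)
  · left
    have h2 : 2 ∈ S := by
      have : 2 ∈ Multiset.replicate (k + 2) 1 + S := Multiset.mem_of_le hle (by simp)
      rw [Multiset.mem_add] at this
      rcases this with h | h
      · have := Multiset.eq_of_mem_replicate h; omega
      · exact h
    refine ⟨h2, ?_⟩
    obtain ⟨S', rfl⟩ := Multiset.exists_cons_of_mem h2
    have e' : ({1, 1} + (Multiset.replicate k 1 + 2 ::ₘ S') : Multiset ℕ)
        = {1, 1, 2} + (Multiset.replicate k 1 + S') := by
      rw [← Multiset.singleton_add 2 S', add_left_comm _ {2} S', ← add_assoc]; rfl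
    rw [hB, e, e', add_tsub_cancel_left, Multiset.erase_cons_head]
  · right
    rw [hB, e, add_tsub_cancel_left]
  · exact (two_big hS le_rfl le_rfl hle).elim
  · exact (two_big hS (by omega) (by omega) hle).elim
  · exact (two_big hS (trib_ge i (by omega)) (trib_ge i (by omega)) hle).elim

theorem aw_self {m t : ℕ} {P : Multiset ℕ} {Q : Multiset ℕ → Prop}
    (h : AllianceWins TribMove 3 (fun q => q = m) t P) (ht : t % 3 + 1 = m)
    (hQ : ∀ B, TribMove P B → Q B ∧ ¬ Terminal TribMove B) :
    ∃ B, Q B ∧ AllianceWins TribMove 3 (fun q => q = m) (t + 1) B := by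
  cases h with
  | endMove _ _ B' hturn' hmove' hterm' => exact absurd hterm' (hQ _ hmove').2
  | contMove _ _ B' hturn' hmove' hwin' => exact ⟨B', (hQ _ hmove').1, hwin'⟩
  | oppMove _ _ hturn' hex' hall' => exact absurd ht hturn'

theorem rep2 (k : ℕ) (S : Multiset ℕ) :
    Multiset.replicate (k + 2) 1 + S = {1, 1} + (Multiset.replicate k 1 + S) := by
  rw [add_comm k 2, Multiset.replicate_add, add_assoc]; rfl

theorem nonterm (k : ℕ) (S : Multiset ℕ) :
    ¬ Terminal TribMove (Multiset.replicate (k + 2) 1 + S) := by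
  intro h; rw [rep2] at h; exact h _ (move11 _)

theorem mv11 (k : ℕ) (S : Multiset ℕ) :
    TribMove (Multiset.replicate (k + 2) 1 + S) (Multiset.replicate k 1 + (S + {2})) := by
  rw [rep2, ← add_assoc (Multiset.replicate k 1)]; exact move11 _

theorem mv112 (k : ℕ) (S : Multiset ℕ) :
    TribMove (Multiset.replicate (k + 2) 1 + ({2} + S)) (Multiset.replicate k 1 + (S + {4})) := by
  have e : ({1, 1} + (Multiset.replicate k 1 + ({2} + S)) : Multiset ℕ)
        = {1, 1, 2} + (Multiset.replicate k 1 + S) := by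
      rw [add_left_comm _ {2} S, ← add_assoc]; rfl
  rw [rep2, e, ← add_assoc (Multiset.replicate k 1)]; exact move112 _

theorem steal' {m t k : ℕ} {S : Multiset ℕ}
    (h : AllianceWins TribMove 3 (fun q => q = m) t (Multiset.replicate (k + 2) 1 + (S + {2})))
    (h0 : t % 3 + 1 ≠ m) (h1 : (t + 1) % 3 + 1 ≠ m) : False := by
  have e : ({1, 1} + (Multiset.replicate k 1 + (S + {2})) : Multiset ℕ)
        = {1, 1, 2} + (Multiset.replicate k 1 + S) := by
      rw [add_comm S, add_left_comm _ {2} S, ← add_assoc]; rfl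
  rw [rep2, e] at h
  exact steal h h0 h1

/-- Position where `m` must move to `S + 2` and then gets robbed. -/
theorem forced {m t k : ℕ} {S : Multiset ℕ} (hS : S.card ≤ 1) (h2 : 2 ∉ S)
    (h : AllianceWins TribMove 3 (fun q => q = m) t (Multiset.replicate (k + 4) 1 + S))
    (h0 : t % 3 + 1 = m) : False := by
  obtain ⟨B, rfl, hw⟩ := aw_self
    (Q := fun B => B = Multiset.replicate (k + 2) 1 + (S + {2})) h h0 (by
    intro B hB
    rcases move_class (k := k + 2) hS hB with ⟨h, -⟩ | h
    · exact absurd h h2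
    · rw [add_assoc] at h
      exact ⟨h, h ▸ nonterm _ _⟩)
  exact steal' hw (by omega) (by omega)

/-- For every integer `n ≥ 13`, no player has a winning strategy in the
three-player Tribonacci game on `n`. -/
theorem three_player_tribonacci_no_winner (n : ℕ) (hn : 13 ≤ n) :
    ∀ m, 1 ≤ m → m ≤ 3 → ¬ PlayerWins TribMove 3 m n := by
  obtain ⟨k, rfl⟩ := Nat.exists_eq_add_of_le' hn
  intro m h1 h3 h
  unfold PlayerWins at h
  rw [← add_zero (Multiset.replicate (k + 13) 1)] at h
  by_cases hm1 : m = 1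
  · exact forced (k := k + 9) (by simp) (by simp) h (by omega)
  have h' := aw_opp h (by omega) (mv11 (k + 11) 0)
  rw [zero_add ({2} : Multiset ℕ)] at h'
  by_cases hm3 : m = 3
  · have h'' := aw_opp (B := Multiset.replicate (k + 9) 1 + (0 + {4})) h' (by omega)
      (mv112 (k + 9) 0)
    exact forced (k := k + 5) (by simp) (by simp) h'' (by omega)
  have hm2 : m = 2 := by omega
  subst hm2
  obtain ⟨B, hB, hw⟩ := aw_self
    (Q := fun B => B = Multiset.replicate (k + 9) 1 + (0 + {4}) ∨
      B = Multiset.replicate (k + 9) 1 + ({2} + {2})) h' (by omega) (by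
    intro B hB
    rcases move_class (k := k + 9) (by simp) hB with ⟨-, h⟩ | h
    · rw [add_assoc] at h
      have h : B = Multiset.replicate (k + 9) 1 + (0 + {4}) := h
      exact ⟨Or.inl h, h ▸ nonterm _ _⟩
    · rw [add_assoc] at h
      exact ⟨Or.inr h, h ▸ nonterm _ _⟩)
  rcases hB with rfl | rfl
  · have h4 := aw_opp hw (by omega) (mv11 (k + 7) _)
    have e : (Multiset.replicate (k + 7) 1 + (0 + {4} + {2}) : Multiset ℕ)
        = {1, 2, 4} + Multiset.replicate (k + 6) 1 := by
      rw [show k + 7 = 1 + (k + 6) by omega, Multiset.replicate_add, zero_add, add_right_comm,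
        add_comm ({4} : Multiset ℕ)]
      rfl
    rw [e] at h4
    have h5 := aw_opp h4 (by omega) (move124 _)
    exact forced (k := k + 2) (by simp) (by simp) h5 (by omega)
  · exact steal' (k := k + 7) hw (by omega) (by omega)
end

section
/- In the two-player (c,k)-nacci Zeckendorf game on n, for every c >= 1, every k >= 1, and every n >= (c+1)^3 + (c+1): if c is odd then Player 2 has a winning strategy, and if c is even then Player 1 has a winning strategy. -/
/-- The `(c,k)`-nacci numbers: `nacci c k 1 = 1`,
`nacci c k (i+1) = c * (nacci c k i + ⋯ + nacci c k 1) + 1` for `1 ≤ i ≤ k`, and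
`nacci c k (i+1) = c * (nacci c k i + ⋯ + nacci c k (i-k))` for `i ≥ k + 1`.
(The value at `0` is junk.) -/
def nacci (c k : ℕ) : ℕ → ℕ
  | 0 => 0
  | 1 => 1
  | (i + 2) =>
    if i + 1 ≤ k then
      c * ((Finset.range (i + 1)).attach.sum fun j => nacci c k (j.1 + 1)) + 1
    else
      c * ((Finset.Icc (i + 1 - k) (i + 1)).attach.sum fun j => nacci c k j.1)
decreasing_by
  · have hj := j.2
    simp only [Finset.mem_range] at hj
    omega
  · have hj := j.2
    simp only [Finset.mem_Icc] at hj
    omega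


/-- The multiset consisting of `c` copies of `nacci c k j` for each `j` in the
finite set `s`. -/
def nacciBlock (c k : ℕ) (s : Finset ℕ) : Multiset ℕ :=
  s.val.bind fun j => Multiset.replicate c (nacci c k j)

/-- A legal move of the `(c,k)`-nacci Zeckendorf game, as a relation between the
position before and the position after the move (positions are multisets of naturals). -/
def CkMove (c k : ℕ) (A B : Multiset ℕ) : Prop :=
  -- (1) for `i ≥ k+1`: `c` copies each of `S_{i-k}, …, S_i` become `S_{i+1}`
  (∃ i, k + 1 ≤ i ∧ nacciBlock c k (Finset.Icc (i - k) i) ≤ A ∧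
    B = A - nacciBlock c k (Finset.Icc (i - k) i) + {nacci c k (i + 1)}) ∨
  -- (2) for `2 ≤ i ≤ k`: `c+1` copies of `S_1` and `c` copies each of `S_2, …, S_i`
  -- become `S_{i+1}`
  (∃ i, 2 ≤ i ∧ i ≤ k ∧
    Multiset.replicate (c + 1) (nacci c k 1) + nacciBlock c k (Finset.Icc 2 i) ≤ A ∧
    B = A - (Multiset.replicate (c + 1) (nacci c k 1) + nacciBlock c k (Finset.Icc 2 i))
        + {nacci c k (i + 1)}) ∨
  -- (3) `c+1` copies of `S_1` become `S_2`
  (Multiset.replicate (c + 1) (nacci c k 1) ≤ A ∧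
    B = A - Multiset.replicate (c + 1) (nacci c k 1) + {nacci c k 2}) ∨
  -- (3) for `1 < i < k+1`: `c+1` copies of `S_i` become `S_{i+1}`
  (∃ i, 1 < i ∧ i < k + 1 ∧ Multiset.replicate (c + 1) (nacci c k i) ≤ A ∧
    B = A - Multiset.replicate (c + 1) (nacci c k i) + {nacci c k (i + 1)}) ∨
  -- (3) `c+1` copies of `S_{k+1}` become `S_{k+2}` and `S_1`
  (Multiset.replicate (c + 1) (nacci c k (k + 1)) ≤ A ∧
    B = A - Multiset.replicate (c + 1) (nacci c k (k + 1))
        + {nacci c k (k + 2), nacci c k 1}) ∨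
  -- (3) for `i > k+1`: `c+1` copies of `S_i` become `S_{i+1}` and `c` copies of `S_{i-k-1}`
  (∃ i, k + 1 < i ∧ Multiset.replicate (c + 1) (nacci c k i) ≤ A ∧
    B = A - Multiset.replicate (c + 1) (nacci c k i)
        + ({nacci c k (i + 1)} + Multiset.replicate c (nacci c k (i - k - 1))))

section NacciAux

theorem nacci_rec_low (c k i : ℕ) (h1 : 1 ≤ i) (h2 : i ≤ k) :
    nacci c k (i + 1) = c * (∑ j ∈ Finset.Icc 1 i, nacci c k j) + 1 := by
  obtain ⟨m, rfl⟩ : ∃ m, i = m + 1 := ⟨i - 1, by omega⟩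
  rw [nacci, if_pos h2, Finset.sum_attach (Finset.range (m + 1)) (fun j => nacci c k (j + 1))]
  congr 2
  rw [Finset.range_eq_Ico, Finset.sum_Ico_add' (fun j => nacci c k j) 0 (m + 1) 1]
  rfl

theorem nacci_rec_high (c k i : ℕ) (h1 : k + 1 ≤ i) :
    nacci c k (i + 1) = c * (∑ j ∈ Finset.Icc (i - k) i, nacci c k j) := by
  obtain ⟨m, rfl⟩ : ∃ m, i = m + 1 := ⟨i - 1, by omega⟩
  rw [nacci, if_neg (by omega), Finset.sum_attach (Finset.Icc (m + 1 - k) (m + 1))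
    (fun j => nacci c k j)]

theorem nacci_at_one (c k : ℕ) : nacci c k 1 = 1 := by rw [nacci]

theorem nacci_idA (c k i : ℕ) (h1 : 1 ≤ i) (h2 : i ≤ k) :
    nacci c k (i + 1) = (c + 1) * nacci c k i := by
  rcases Nat.eq_or_lt_of_le h1 with h | h
  · subst h
    rw [nacci_rec_low c k 1 le_rfl h2]
    simp [nacci_at_one]
  · obtain ⟨m, rfl⟩ : ∃ m, i = m + 1 := ⟨i - 1, by omega⟩
    rw [nacci_rec_low c k (m + 1) h1 h2, Finset.sum_Icc_succ_top (by omega)]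
    have := nacci_rec_low c k m (by omega) (by omega)
    linarith

theorem nacci_idB (c k : ℕ) (hk : 1 ≤ k) :
    nacci c k (k + 2) + 1 = (c + 1) * nacci c k (k + 1) := by
  rw [nacci_rec_high c k (k + 1) le_rfl, show k + 1 - k = 1 by omega,
    Finset.sum_Icc_succ_top (by omega)]
  have := nacci_rec_low c k k hk le_rfl
  linarith

theorem nacci_idC (c k i : ℕ) (h : k + 1 < i) :
    nacci c k (i + 1) + c * nacci c k (i - k - 1) = (c + 1) * nacci c k i := by
  obtain ⟨m, rfl⟩ : ∃ m, i = m + k + 2 := ⟨i - k - 2, by omega⟩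
  have e1 := nacci_rec_high c k (m + k + 2) (by omega)
  have e2 := nacci_rec_high c k (m + k + 1) (by omega)
  rw [show m + k + 2 - k = m + 2 by omega, Finset.sum_Icc_succ_top (by omega)] at e1
  rw [show m + k + 1 - k = m + 1 by omega, ← Finset.add_sum_Ioc_eq_sum_Icc (by omega)] at e2
  have e3 : Finset.Ioc (m + 1) (m + k + 1) = Finset.Icc (m + 2) (m + k + 1) := by
    ext x; simp; omega
  rw [e3] at e2
  rw [show m + k + 2 - k - 1 = m + 1 by omega]
  have e4 : nacci c k (m + k + 2) = nacci c k (m + k + 1 + 1) := rfl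
  rw [e1, ← e4] at *
  linarith

theorem nacci_pos (c k : ℕ) (hc : 1 ≤ c) : ∀ i, 1 ≤ i → 1 ≤ nacci c k i := by
  intro i
  induction i using Nat.strong_induction_on with
  | _ i ih =>
    intro hi
    rcases Nat.eq_or_lt_of_le hi with h | h
    · subst h; rw [nacci_at_one]
    · obtain ⟨m, rfl⟩ : ∃ m, i = m + 1 := ⟨i - 1, by omega⟩
      by_cases hm : m ≤ k
      · rw [nacci_rec_low c k m (by omega) hm]; omega
      · rw [nacci_rec_high c k m (by omega)]
        have h1 := ih m (by omega) (by omega)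
        have h2 : nacci c k m ≤ ∑ j ∈ Finset.Icc (m - k) m, nacci c k j :=
          Finset.single_le_sum (f := fun j => nacci c k j) (fun _ _ => Nat.zero_le _)
            (by simp)
        nlinarith

theorem nacci_lt_succ (c k : ℕ) (hc : 1 ≤ c) (hk : 1 ≤ k) (i : ℕ) (hi : 1 ≤ i) :
    nacci c k i < nacci c k (i + 1) := by
  have hp := nacci_pos c k hc i hi
  by_cases h : i ≤ k
  · rw [nacci_idA c k i hi h]; nlinarith
  · obtain ⟨m, rfl⟩ : ∃ m, i = m + 1 := ⟨i - 1, by omega⟩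
    rw [nacci_rec_high c k (m + 1) (by omega), Finset.sum_Icc_succ_top (by omega)]
    have h1 := nacci_pos c k hc m (by omega)
    have h2 : nacci c k m ≤ ∑ j ∈ Finset.Icc (m + 1 - k) m, nacci c k j :=
      Finset.single_le_sum (f := fun j => nacci c k j) (fun _ _ => Nat.zero_le _)
        (by simp; omega)
    nlinarith

theorem nacci_lt (c k : ℕ) (hc : 1 ≤ c) (hk : 1 ≤ k) (i j : ℕ) (hi : 1 ≤ i) (hij : i < j) :
    nacci c k i < nacci c k j := by
  induction j with
  | zero => omega
  | succ j ih =>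
    have := nacci_lt_succ c k hc hk j (by omega)
    rcases Nat.lt_or_ge i j with h | h
    · exact (ih h).trans this
    · have : i = j := by omega
      subst this; assumption

theorem nacci_inj (c k : ℕ) (hc : 1 ≤ c) (hk : 1 ≤ k) (i j : ℕ) (hi : 1 ≤ i) (hj : 1 ≤ j) :
    nacci c k i = nacci c k j ↔ i = j := by
  constructor
  · intro h
    rcases lt_trichotomy i j with h' | h' | h'
    · have := nacci_lt c k hc hk i j hi h'; omega
    · exact h'
    · have := nacci_lt c k hc hk j i hj h'; omega
  · rintro rfl; rfl

/-- Sum of squares of the entries. -/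
def sqSum (A : Multiset ℕ) : ℕ := (A.map (fun x => x ^ 2)).sum

theorem sqSum_add (A B : Multiset ℕ) : sqSum (A + B) = sqSum A + sqSum B := by
  simp [sqSum]

theorem sqSum_le_mul (A : Multiset ℕ) (v : ℕ) (h : ∀ x ∈ A, x ≤ v) : sqSum A ≤ v * A.sum := by
  induction A using Multiset.induction_on with
  | empty => simp [sqSum]
  | cons a A ih =>
    have h1 := ih (fun x hx => h x (Multiset.mem_cons_of_mem hx))
    have h2 := h a (Multiset.mem_cons_self a A)
    simp only [sqSum, Multiset.map_cons, Multiset.sum_cons] at *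
    nlinarith

theorem sqSum_le (A : Multiset ℕ) : sqSum A ≤ A.sum ^ 2 := by
  have := sqSum_le_mul A A.sum (fun x hx => Multiset.single_le_sum (by simp) x hx)
  nlinarith

theorem sqSum_lt (A : Multiset ℕ) (v : ℕ) (h : ∀ x ∈ A, x < v) (hs : A.sum = v) (hv : 1 ≤ v) :
    sqSum A < v ^ 2 := by
  have := sqSum_le_mul A (v - 1) (fun x hx => by have := h x hx; omega)
  obtain ⟨w, rfl⟩ : ∃ w, v = w + 1 := ⟨v - 1, by omega⟩
  rw [hs] at this
  simp only [Nat.add_sub_cancel] at this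
  nlinarith

theorem nacciBlock_sum (c k : ℕ) (s : Finset ℕ) :
    (nacciBlock c k s).sum = c * ∑ j ∈ s, nacci c k j := by
  rw [nacciBlock, Multiset.sum_bind, Finset.mul_sum]
  simp only [Multiset.sum_replicate, smul_eq_mul]
  rfl

theorem mem_nacciBlock (c k : ℕ) (s : Finset ℕ) (x : ℕ) (h : x ∈ nacciBlock c k s) :
    ∃ j ∈ s, x = nacci c k j := by
  rw [nacciBlock, Multiset.mem_bind] at h
  obtain ⟨j, hj, hx⟩ := h
  exact ⟨j, hj, Multiset.eq_of_mem_replicate hx⟩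

theorem replicate_le_nacciBlock (c k : ℕ) (s : Finset ℕ) (j : ℕ) (hj : j ∈ s) :
    Multiset.replicate c (nacci c k j) ≤ nacciBlock c k s := by
  rw [nacciBlock]
  exact Multiset.le_bind _ (f := fun j => Multiset.replicate c (nacci c k j)) hj

theorem measure_drop (A B R T : Multiset ℕ) (hR : R ≤ A) (hB : B = A - R + T)
    (hs : R.sum = T.sum) (hq : sqSum R < sqSum T) :
    B.sum ^ 2 - sqSum B < A.sum ^ 2 - sqSum A := by
  obtain ⟨D, rfl⟩ := Multiset.le_iff_exists_add.1 hR
  rw [add_tsub_cancel_left] at hB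
  subst hB
  have h1 := sqSum_le (D + T)
  have h2 : (D + T).sum = (R + D).sum := by simp [hs, add_comm]
  rw [h2] at h1 ⊢
  rw [sqSum_add] at h1 ⊢
  rw [sqSum_add]
  omega

theorem CkMove_measure (c k : ℕ) (hc : 1 ≤ c) (hk : 1 ≤ k) (A B : Multiset ℕ)
    (h : CkMove c k A B) : B.sum ^ 2 - sqSum B < A.sum ^ 2 - sqSum A := by
  have merge : ∀ (R : Multiset ℕ) (i : ℕ), R ≤ A → B = A - R + {nacci c k (i + 1)} →
      (∀ x ∈ R, ∃ j, 1 ≤ j ∧ j ≤ i ∧ x = nacci c k j) → R.sum = nacci c k (i + 1) →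
      B.sum ^ 2 - sqSum B < A.sum ^ 2 - sqSum A := by
    intro R i h1 h2 h3 h4
    refine measure_drop A B R _ h1 h2 (by simpa using h4) ?_
    have := sqSum_lt R (nacci c k (i + 1)) ?_ h4 (nacci_pos c k hc _ (by omega))
    · simpa [sqSum] using this
    · intro x hx
      obtain ⟨j, hj1, hj2, rfl⟩ := h3 x hx
      exact nacci_lt c k hc hk _ _ hj1 (by omega)
  rcases h with ⟨i, hi, hle, hB⟩ | ⟨i, hi, hik, hle, hB⟩ | ⟨hle, hB⟩ | ⟨i, hi, hik, hle, hB⟩ |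
    ⟨hle, hB⟩ | ⟨i, hi, hle, hB⟩
  · refine merge _ i hle hB ?_ ?_
    · intro x hx
      obtain ⟨j, hj, rfl⟩ := mem_nacciBlock _ _ _ _ hx
      simp at hj
      exact ⟨j, by omega, by omega, rfl⟩
    · rw [nacciBlock_sum, nacci_rec_high c k i hi]
  · refine merge _ i hle hB ?_ ?_
    · intro x hx
      rcases Multiset.mem_add.1 hx with hx | hx
      · exact ⟨1, le_rfl, by omega, Multiset.eq_of_mem_replicate hx⟩
      · obtain ⟨j, hj, rfl⟩ := mem_nacciBlock _ _ _ _ hx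
        simp at hj
        exact ⟨j, by omega, by omega, rfl⟩
    · rw [Multiset.sum_add, nacciBlock_sum, nacci_rec_low c k i (by omega) hik,
        ← Finset.add_sum_Ioc_eq_sum_Icc (show 1 ≤ i by omega)]
      have e3 : Finset.Ioc 1 i = Finset.Icc 2 i := by
        ext x; simp; omega
      rw [e3, nacci_at_one]
      simp
      ring
  · refine merge _ 1 hle hB ?_ ?_
    · intro x hx
      exact ⟨1, le_rfl, by omega, Multiset.eq_of_mem_replicate hx⟩
    · rw [nacci_idA c k 1 le_rfl hk, Multiset.sum_replicate, smul_eq_mul]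
  · refine merge _ i hle hB ?_ ?_
    · intro x hx
      exact ⟨i, by omega, le_rfl, Multiset.eq_of_mem_replicate hx⟩
    · rw [nacci_idA c k i (by omega) (by omega), Multiset.sum_replicate, smul_eq_mul]
  · have e := nacci_idB c k hk
    refine measure_drop A B _ _ hle hB ?_ ?_
    · rw [Multiset.sum_replicate, smul_eq_mul, ← e]; simp [nacci_at_one]
    · have hy : 2 ≤ nacci c k (k + 1) := by
        have := nacci_lt c k hc hk 1 (k + 1) le_rfl (by omega)
        rw [nacci_at_one] at this; omega
      simp only [sqSum, Multiset.map_replicate, Multiset.sum_replicate, Multiset.insert_eq_cons,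
        Multiset.map_cons, Multiset.map_singleton, Multiset.sum_cons, Multiset.sum_singleton,
        nacci_at_one, smul_eq_mul]
      generalize nacci c k (k + 1) = y at *
      generalize nacci c k (k + 2) = z at *
      have hz : z + 1 ≥ 2 * y := by nlinarith
      have h3 : (z + 1) ^ 2 = (c + 1) * y * (z + 1) := by rw [e]; ring
      zify at *
      nlinarith [mul_nonneg (show (0:ℤ) ≤ (c + 1) * y by positivity)
        (show (0:ℤ) ≤ z + 1 - y - 2 + (2 - y + y) - 2 + 2 by nlinarith)]
  · have e := nacci_idC c k i hi
    have hlt := nacci_lt_succ c k hc hk i (by omega)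
    refine measure_drop A B _ _ hle hB ?_ ?_
    · rw [Multiset.sum_replicate, smul_eq_mul, ← e]; simp
    · simp only [sqSum, Multiset.map_replicate, Multiset.sum_replicate, Multiset.map_add,
        Multiset.map_singleton, Multiset.sum_add, Multiset.sum_singleton, smul_eq_mul]
      generalize nacci c k i = y at *
      generalize nacci c k (i + 1) = z at *
      generalize nacci c k (i - k - 1) = w at *
      obtain ⟨t, rfl⟩ : ∃ t, z = y + t := ⟨z - y, by omega⟩
      have ht : 0 < t := by omega
      have h1 : c * w + t = c * y := by linarith
      have hwy : w ≤ y := by nlinarith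
      obtain ⟨u, rfl⟩ : ∃ u, y = w + u := ⟨y - w, by omega⟩
      have h2 : t = c * u := by nlinarith
      subst h2
      nlinarith [mul_pos ht ht]

/-! ### The game layer -/

theorem ck_wf (c k : ℕ) (hc : 1 ≤ c) (hk : 1 ≤ k) :
    WellFounded (fun B A : Multiset ℕ => CkMove c k A B) :=
  Subrelation.wf (r := fun B A : Multiset ℕ => B.sum ^ 2 - sqSum B < A.sum ^ 2 - sqSum A)
    (fun {B A} h => CkMove_measure c k hc hk A B h)
    (InvImage.wf (fun A : Multiset ℕ => A.sum ^ 2 - sqSum A) wellFounded_lt)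

theorem exists_win (Move : Multiset ℕ → Multiset ℕ → Prop)
    (wf : WellFounded (fun B A : Multiset ℕ => Move A B)) :
    ∃ W : Multiset ℕ → Prop, ∀ A, W A ↔ ∃ B, Move A B ∧ ¬ W B := by
  refine ⟨wf.fix (fun A ih => ∃ B, ∃ h : Move A B, ¬ ih B h), fun A => ?_⟩
  rw [wf.fix_eq]
  simp only [exists_prop]

theorem win_alliance (Move : Multiset ℕ → Multiset ℕ → Prop)
    (wf : WellFounded (fun B A : Multiset ℕ => Move A B)) (W : Multiset ℕ → Prop)
    (hW : ∀ A, W A ↔ ∃ B, Move A B ∧ ¬ W B) (m : ℕ) (hm : m = 1 ∨ m = 2) (A : Multiset ℕ) :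
    ∀ t, (t % 2 + 1 = m → W A → AllianceWins Move 2 (fun q => q = m) t A) ∧
      (t % 2 + 1 ≠ m → ¬ W A → (∃ B, Move A B) →
        AllianceWins Move 2 (fun q => q = m) t A) := by
  induction A using wf.induction with
  | _ A ih =>
    intro t
    constructor
    · intro ht hA
      obtain ⟨B, hB, hBW⟩ := (hW A).1 hA
      by_cases hT : ∃ C, Move B C
      · exact .contMove t A B ht hB ((ih B hB (t + 1)).2 (by omega) hBW hT)
      · exact .endMove t A B ht hB (fun C hC => hT ⟨C, hC⟩)
    · intro ht hA hex
      refine .oppMove t A ht hex (fun B hB => (ih B hB (t + 1)).1 (by omega) ?_)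
      by_contra hBW
      exact hA ((hW A).2 ⟨B, hB, hBW⟩)

/-! ### Positions -/

/-- Position with given multiplicities of the first four numbers. -/
def ckPos (c k x a b d : ℕ) : Multiset ℕ :=
  Multiset.replicate x (nacci c k 1) + Multiset.replicate a (nacci c k 2) +
  Multiset.replicate b (nacci c k 3) + Multiset.replicate d (nacci c k 4)

/-- correction for three -/
def rr (k : ℕ) : ℕ := if k = 1 then 1 else 0
/-- correction for four -/
def ss (c k : ℕ) : ℕ := if k = 1 then c else if k = 2 then 1 else 0

theorem ckPos_count (c k x a b d : ℕ) (hc : 1 ≤ c) (hk : 1 ≤ k) (j : ℕ) (hj : 1 ≤ j) :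
    Multiset.count (nacci c k j) (ckPos c k x a b d) =
      (if j = 1 then x else 0) + (if j = 2 then a else 0) + (if j = 3 then b else 0)
        + (if j = 4 then d else 0) := by
  simp only [ckPos, Multiset.count_add, Multiset.count_replicate]
  simp only [nacci_inj c k hc hk 1 j (by omega) hj, nacci_inj c k hc hk 2 j (by omega) hj,
    nacci_inj c k hc hk 3 j (by omega) hj, nacci_inj c k hc hk 4 j (by omega) hj]
  simp only [@eq_comm _ j]

theorem sub_add_eq_of (A R T C : Multiset ℕ) (h : R ≤ A) (e : A + T = C + R) :
    A - R + T = C := by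
  rw [tsub_add_eq_add_tsub h, e, add_tsub_cancel_right]

theorem block12 (c k : ℕ) : nacciBlock c k (Finset.Icc 1 2) =
    Multiset.replicate c (nacci c k 1) + Multiset.replicate c (nacci c k 2) := by
  rw [show Finset.Icc 1 2 = ({1, 2} : Finset ℕ) by decide]
  simp [nacciBlock]

theorem block22 (c k : ℕ) : nacciBlock c k (Finset.Icc 2 2) =
    Multiset.replicate c (nacci c k 2) := by
  simp [nacciBlock]

theorem block23 (c k : ℕ) : nacciBlock c k (Finset.Icc 2 3) =
    Multiset.replicate c (nacci c k 2) + Multiset.replicate c (nacci c k 3) := by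
  rw [show Finset.Icc 2 3 = ({2, 3} : Finset ℕ) by decide]
  simp [nacciBlock]

theorem block13 (c k : ℕ) : nacciBlock c k (Finset.Icc 1 3) =
    Multiset.replicate c (nacci c k 1) + (Multiset.replicate c (nacci c k 2)
      + Multiset.replicate c (nacci c k 3)) := by
  rw [show Finset.Icc 1 3 = ({1, 2, 3} : Finset ℕ) by decide]
  simp [nacciBlock]

theorem ckMove_options (c k x a b d : ℕ) (hc : 1 ≤ c) (hk : 1 ≤ k) (B : Multiset ℕ)
    (hab : a < c ∨ b < c) (hbd : b < c ∨ d < c) (hd : d ≤ c)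
    (h : CkMove c k (ckPos c k x a b d) B) :
    (c + 1 ≤ x ∧ B = ckPos c k (x - (c + 1)) (a + 1) b d) ∨
    (c + 1 ≤ a ∧ B = ckPos c k (x + rr k) (a - (c + 1)) (b + 1) d) ∨
    (c ≤ a ∧ c + 1 - rr k ≤ x ∧ B = ckPos c k (x - (c + 1 - rr k)) (a - c) (b + 1) d) ∨
    (c + 1 ≤ b ∧ B = ckPos c k (x + ss c k) a (b - (c + 1)) (d + 1)) := by
  have cnt : ∀ (R : Multiset ℕ) (m j : ℕ), R ≤ ckPos c k x a b d → 1 ≤ j →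
      Multiset.replicate m (nacci c k j) ≤ R →
      m ≤ (if j = 1 then x else 0) + (if j = 2 then a else 0) + (if j = 3 then b else 0)
        + (if j = 4 then d else 0) := by
    intro R m j hR hj hm
    rw [← ckPos_count c k x a b d hc hk j hj]
    exact Multiset.le_count_iff_replicate_le.2 (hm.trans hR)
  have fin : ∀ (R T C : Multiset ℕ), R ≤ ckPos c k x a b d →
      B = ckPos c k x a b d - R + T → ckPos c k x a b d + T = C + R → B = C := by
    intro R T C h1 h2 h3
    rw [h2]; exact sub_add_eq_of _ _ _ _ h1 h3
  rcases h with ⟨i, hi, hle, hB⟩ | ⟨i, hi, hik, hle, hB⟩ | ⟨hle, hB⟩ | ⟨i, hi, hik, hle, hB⟩ |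
    ⟨hle, hB⟩ | ⟨i, hi, hle, hB⟩
  · have h1 := cnt _ c i hle (by omega) (replicate_le_nacciBlock c k _ i (by simp))
    have h2 := cnt _ c (i - 1) hle (by omega)
      (replicate_le_nacciBlock c k _ (i - 1) (by simp; omega))
    have : i = 2 := by split_ifs at h1 h2 <;> omega
    subst this
    have : k = 1 := by omega
    subst this
    rw [show 2 - 1 = 1 by rfl, block12] at hle hB
    have h3 := cnt _ c 1 hle le_rfl (by simp)
    simp at h1 h3
    right; right; left
    refine ⟨h1, by simpa [rr] using h3, fin _ _ _ hle hB ?_⟩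
    ext v
    simp only [ckPos, rr, Multiset.count_add, Multiset.count_replicate, Multiset.count_singleton,
      @eq_comm _ v, if_true, Nat.reduceAdd]
    split_ifs <;> omega
  · have h1 := cnt _ c i hle (by omega)
      ((replicate_le_nacciBlock c k _ i (by simp; omega)).trans (Multiset.le_add_left _ _))
    have h4 : i = 2 ∨ c ≤ (if i - 1 = 1 then x else 0) + (if i - 1 = 2 then a else 0)
        + (if i - 1 = 3 then b else 0) + (if i - 1 = 4 then d else 0) := by
      by_cases h : i = 2
      · exact Or.inl h
      · exact Or.inr (cnt _ c (i - 1) hle (by omega)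
          ((replicate_le_nacciBlock c k _ (i - 1) (by simp; omega)).trans
            (Multiset.le_add_left _ _)))
    have : i = 2 := by
      rcases h4 with h4 | h2
      · exact h4
      · split_ifs at h1 h2 <;> omega
    subst this
    rw [block22] at hle hB
    have h3 := cnt _ (c + 1) 1 hle le_rfl (by simp)
    simp at h1 h3
    have hr : rr k = 0 := by rw [rr, if_neg (by omega)]
    right; right; left
    refine ⟨h1, by omega, fin _ _ _ hle hB ?_⟩
    ext v
    simp only [ckPos, hr, Multiset.count_add, Multiset.count_replicate, Multiset.count_singleton,
      @eq_comm _ v, Nat.reduceAdd]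
    split_ifs <;> omega
  · have h1 := cnt _ _ 1 hle le_rfl le_rfl
    simp at h1
    left
    refine ⟨h1, fin _ _ _ hle hB ?_⟩
    ext v
    simp only [ckPos, Multiset.count_add, Multiset.count_replicate, Multiset.count_singleton,
      @eq_comm _ v, Nat.reduceAdd]
    split_ifs <;> omega
  · have h1 := cnt _ _ i hle (by omega) le_rfl
    have : i = 2 ∨ i = 3 := by split_ifs at h1 <;> omega
    rcases this with rfl | rfl
    · simp at h1
      have hr : rr k = 0 := by rw [rr, if_neg (by omega)]
      right; left
      refine ⟨h1, fin _ _ _ hle hB ?_⟩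
      ext v
      simp only [ckPos, hr, Multiset.count_add, Multiset.count_replicate,
        Multiset.count_singleton, @eq_comm _ v, Nat.reduceAdd]
      split_ifs <;> omega
    · simp at h1
      have hr : ss c k = 0 := by rw [ss, if_neg (by omega), if_neg (by omega)]
      right; right; right
      refine ⟨h1, fin _ _ _ hle hB ?_⟩
      ext v
      simp only [ckPos, hr, Multiset.count_add, Multiset.count_replicate,
        Multiset.count_singleton, @eq_comm _ v, Nat.reduceAdd]
      split_ifs <;> omega
  · have h1 := cnt _ _ _ hle (by omega) le_rfl
    have : k = 1 ∨ k = 2 := by split_ifs at h1 <;> omega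
    rw [show ({nacci c k (k + 2), nacci c k 1} : Multiset ℕ) =
      {nacci c k (k + 2)} + {nacci c k 1} by rfl] at hB
    rcases this with rfl | rfl
    · simp at h1
      right; left
      refine ⟨h1, fin _ _ _ hle hB ?_⟩
      ext v
      simp only [ckPos, rr, Multiset.count_add, Multiset.count_replicate,
        Multiset.count_singleton, @eq_comm _ v, Nat.reduceAdd, if_true]
      split_ifs <;> omega
    · simp at h1
      have hr : ss c 2 = 1 := by simp [ss]
      right; right; right
      refine ⟨h1, fin _ _ _ hle hB ?_⟩
      ext v
      simp only [ckPos, hr, Multiset.count_add, Multiset.count_replicate,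
        Multiset.count_singleton, @eq_comm _ v, Nat.reduceAdd]
      split_ifs <;> omega
  · have h1 := cnt _ _ _ hle (by omega) le_rfl
    have : i = 3 := by split_ifs at h1 <;> omega
    subst this
    have : k = 1 := by omega
    subst this
    simp at h1
    have hr : ss c 1 = c := by simp [ss]
    right; right; right
    refine ⟨h1, fin _ _ _ hle hB ?_⟩
    ext v
    simp only [ckPos, hr, Multiset.count_add, Multiset.count_replicate,
      Multiset.count_singleton, @eq_comm _ v, Nat.reduceAdd, Nat.reduceSub]
    split_ifs <;> omega

theorem ex1 (c k x a b d : ℕ) (h : c + 1 ≤ x) :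
    CkMove c k (ckPos c k x a b d) (ckPos c k (x - (c + 1)) (a + 1) b d) := by
  have hle : Multiset.replicate (c + 1) (nacci c k 1) ≤ ckPos c k x a b d := by
    rw [Multiset.le_iff_count]; intro v
    simp only [ckPos, Multiset.count_add, Multiset.count_replicate]
    split_ifs <;> omega
  refine Or.inr (Or.inr (Or.inl ⟨hle, (sub_add_eq_of _ _ _ _ hle ?_).symm⟩))
  ext v
  simp only [ckPos, Multiset.count_add, Multiset.count_replicate,
    Multiset.count_singleton, @eq_comm _ v]
  split_ifs <;> omega

theorem ex2 (c k x a b d : ℕ) (hk : 1 ≤ k) (h : c + 1 ≤ a) :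
    CkMove c k (ckPos c k x a b d) (ckPos c k (x + rr k) (a - (c + 1)) (b + 1) d) := by
  have hle : Multiset.replicate (c + 1) (nacci c k 2) ≤ ckPos c k x a b d := by
    rw [Multiset.le_iff_count]; intro v
    simp only [ckPos, Multiset.count_add, Multiset.count_replicate]
    split_ifs <;> omega
  by_cases hk1 : k = 1
  · subst hk1
    refine Or.inr (Or.inr (Or.inr (Or.inr (Or.inl ⟨hle, (sub_add_eq_of _ _ _ _ hle ?_).symm⟩))))
    rw [show ({nacci c 1 (1 + 2), nacci c 1 1} : Multiset ℕ) =
      {nacci c 1 3} + {nacci c 1 1} by rfl]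
    ext v
    simp only [ckPos, rr, Multiset.count_add, Multiset.count_replicate,
      Multiset.count_singleton, @eq_comm _ v, if_true, Nat.reduceAdd]
    split_ifs <;> omega
  · refine Or.inr (Or.inr (Or.inr (Or.inl ⟨2, by omega, by omega, hle,
      (sub_add_eq_of _ _ _ _ hle ?_).symm⟩)))
    ext v
    simp only [ckPos, rr, Multiset.count_add, Multiset.count_replicate,
      Multiset.count_singleton, @eq_comm _ v, if_neg hk1, Nat.reduceAdd]
    split_ifs <;> omega

theorem ex12 (c k x a b d : ℕ) (hk : 1 ≤ k) (h : c ≤ a) (hx : c + 1 - rr k ≤ x) :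
    CkMove c k (ckPos c k x a b d) (ckPos c k (x - (c + 1 - rr k)) (a - c) (b + 1) d) := by
  by_cases hk1 : k = 1
  · subst hk1
    have hr : rr 1 = 1 := by simp [rr]
    rw [hr] at hx ⊢
    refine Or.inl ⟨2, by omega, ?_⟩
    rw [show 2 - 1 = 1 by rfl, block12]
    have hle : Multiset.replicate c (nacci c 1 1) + Multiset.replicate c (nacci c 1 2)
        ≤ ckPos c 1 x a b d := by
      rw [Multiset.le_iff_count]; intro v
      simp only [ckPos, Multiset.count_add, Multiset.count_replicate]
      split_ifs <;> omega
    refine ⟨hle, (sub_add_eq_of _ _ _ _ hle ?_).symm⟩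
    ext v
    simp only [ckPos, Multiset.count_add, Multiset.count_replicate,
      Multiset.count_singleton, @eq_comm _ v, Nat.reduceAdd]
    split_ifs <;> omega
  · have hr : rr k = 0 := by simp [rr, hk1]
    rw [hr] at hx ⊢
    refine Or.inr (Or.inl ⟨2, by omega, by omega, ?_⟩)
    rw [block22]
    have hle : Multiset.replicate (c + 1) (nacci c k 1) + Multiset.replicate c (nacci c k 2)
        ≤ ckPos c k x a b d := by
      rw [Multiset.le_iff_count]; intro v
      simp only [ckPos, Multiset.count_add, Multiset.count_replicate]
      split_ifs <;> omega
    refine ⟨hle, (sub_add_eq_of _ _ _ _ hle ?_).symm⟩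
    ext v
    simp only [ckPos, Multiset.count_add, Multiset.count_replicate,
      Multiset.count_singleton, @eq_comm _ v, Nat.reduceAdd]
    split_ifs <;> omega

theorem ex3 (c k x a b d : ℕ) (hk : 1 ≤ k) (h : c + 1 ≤ b) :
    CkMove c k (ckPos c k x a b d) (ckPos c k (x + ss c k) a (b - (c + 1)) (d + 1)) := by
  have hle : Multiset.replicate (c + 1) (nacci c k 3) ≤ ckPos c k x a b d := by
    rw [Multiset.le_iff_count]; intro v
    simp only [ckPos, Multiset.count_add, Multiset.count_replicate]
    split_ifs <;> omega
  by_cases hk1 : k = 1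
  · subst hk1
    have hr : ss c 1 = c := by simp [ss]
    refine Or.inr (Or.inr (Or.inr (Or.inr (Or.inr ⟨3, by omega, hle,
      (sub_add_eq_of _ _ _ _ hle ?_).symm⟩))))
    ext v
    simp only [ckPos, hr, Multiset.count_add, Multiset.count_replicate,
      Multiset.count_singleton, @eq_comm _ v, Nat.reduceAdd, Nat.reduceSub]
    split_ifs <;> omega
  by_cases hk2 : k = 2
  · subst hk2
    have hr : ss c 2 = 1 := by simp [ss]
    refine Or.inr (Or.inr (Or.inr (Or.inr (Or.inl ⟨hle, (sub_add_eq_of _ _ _ _ hle ?_).symm⟩))))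
    rw [show ({nacci c 2 (2 + 2), nacci c 2 1} : Multiset ℕ) =
      {nacci c 2 4} + {nacci c 2 1} by rfl]
    ext v
    simp only [ckPos, hr, Multiset.count_add, Multiset.count_replicate,
      Multiset.count_singleton, @eq_comm _ v, Nat.reduceAdd]
    split_ifs <;> omega
  · have hr : ss c k = 0 := by simp [ss, hk1, hk2]
    refine Or.inr (Or.inr (Or.inr (Or.inl ⟨3, by omega, by omega, hle,
      (sub_add_eq_of _ _ _ _ hle ?_).symm⟩)))
    ext v
    simp only [ckPos, hr, Multiset.count_add, Multiset.count_replicate,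
      Multiset.count_singleton, @eq_comm _ v, Nat.reduceAdd]
    split_ifs <;> omega

theorem ex123 (c k x a b d : ℕ) (hk : 1 ≤ k) (ha : c ≤ a) (hb : c ≤ b)
    (hx : c + 1 - rr k - ss c k ≤ x) :
    CkMove c k (ckPos c k x a b d)
      (ckPos c k (x - (c + 1 - rr k - ss c k)) (a - c) (b - c) (d + 1)) := by
  by_cases hk1 : k = 1
  · subst hk1
    have hr : c + 1 - rr 1 - ss c 1 = 0 := by simp [ss, rr]
    rw [hr] at hx ⊢
    refine Or.inl ⟨3, by omega, ?_⟩
    rw [show 3 - 1 = 2 by rfl, block23]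
    have hle : Multiset.replicate c (nacci c 1 2) + Multiset.replicate c (nacci c 1 3)
        ≤ ckPos c 1 x a b d := by
      rw [Multiset.le_iff_count]; intro v
      simp only [ckPos, Multiset.count_add, Multiset.count_replicate]
      split_ifs <;> omega
    refine ⟨hle, (sub_add_eq_of _ _ _ _ hle ?_).symm⟩
    ext v
    simp only [ckPos, Multiset.count_add, Multiset.count_replicate,
      Multiset.count_singleton, @eq_comm _ v, Nat.reduceAdd]
    split_ifs <;> omega
  by_cases hk2 : k = 2
  · subst hk2
    have hr : c + 1 - rr 2 - ss c 2 = c := by simp [ss, rr]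
    rw [hr] at hx ⊢
    refine Or.inl ⟨3, by omega, ?_⟩
    rw [show 3 - 2 = 1 by rfl, block13]
    have hle : Multiset.replicate c (nacci c 2 1) + (Multiset.replicate c (nacci c 2 2) +
        Multiset.replicate c (nacci c 2 3)) ≤ ckPos c 2 x a b d := by
      rw [Multiset.le_iff_count]; intro v
      simp only [ckPos, Multiset.count_add, Multiset.count_replicate]
      split_ifs <;> omega
    refine ⟨hle, (sub_add_eq_of _ _ _ _ hle ?_).symm⟩
    ext v
    simp only [ckPos, Multiset.count_add, Multiset.count_replicate,
      Multiset.count_singleton, @eq_comm _ v, Nat.reduceAdd]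
    split_ifs <;> omega
  · have hr : c + 1 - rr k - ss c k = c + 1 := by simp [ss, rr, hk1, hk2]
    rw [hr] at hx ⊢
    refine Or.inr (Or.inl ⟨3, by omega, by omega, ?_⟩)
    rw [block23]
    have hle : Multiset.replicate (c + 1) (nacci c k 1) + (Multiset.replicate c (nacci c k 2) +
        Multiset.replicate c (nacci c k 3)) ≤ ckPos c k x a b d := by
      rw [Multiset.le_iff_count]; intro v
      simp only [ckPos, Multiset.count_add, Multiset.count_replicate]
      split_ifs <;> omega
    refine ⟨hle, (sub_add_eq_of _ _ _ _ hle ?_).symm⟩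
    ext v
    simp only [ckPos, Multiset.count_add, Multiset.count_replicate,
      Multiset.count_singleton, @eq_comm _ v, Nat.reduceAdd]
    split_ifs <;> omega

theorem nacci_two (c k : ℕ) (hk : 1 ≤ k) : nacci c k 2 = c + 1 := by
  rw [nacci_idA c k 1 le_rfl hk, nacci_at_one, mul_one]

theorem nacci_three (c k : ℕ) (hk : 1 ≤ k) : nacci c k 3 + rr k = (c + 1) * (c + 1) := by
  by_cases hk1 : k = 1
  · subst hk1
    have := nacci_idB c 1 le_rfl
    simp only [rr, if_true]
    rw [this, nacci_two c 1 le_rfl]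
  · have := nacci_idA c k 2 (by omega) (by omega)
    rw [this, nacci_two c k hk, rr, if_neg hk1, add_zero]

theorem nacci_four (c k : ℕ) (hk : 1 ≤ k) :
    nacci c k 4 + ss c k = (c + 1) * nacci c k 3 := by
  by_cases hk1 : k = 1
  · subst hk1
    have := nacci_idC c 1 3 (by omega)
    rw [show 3 - 1 - 1 = 1 by rfl, nacci_at_one, mul_one] at this
    simpa [ss] using this
  by_cases hk2 : k = 2
  · subst hk2
    simpa [ss] using nacci_idB c 2 (by omega)
  · simpa [ss, hk1, hk2] using nacci_idA c k 3 (by omega) (by omega)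

/-- Total value of the non-unit part. -/
def ckVal (c k a b d : ℕ) : ℕ := a * nacci c k 2 + b * nacci c k 3 + d * nacci c k 4

/-- The position with `a`, `b`, `d` copies of the second, third, fourth number, total `n`. -/
def ckU (c k n a b d : ℕ) : Multiset ℕ := ckPos c k (n - ckVal c k a b d) a b d

theorem val1 (c k a b d : ℕ) (hk : 1 ≤ k) :
    ckVal c k (a + 1) b d = ckVal c k a b d + (c + 1) := by
  rw [ckVal, ckVal, ← nacci_two c k hk]; ring

theorem val2 (c k a b d : ℕ) (hk : 1 ≤ k) :
    ckVal c k (a + (c + 1)) b d = ckVal c k a (b + 1) d + rr k := by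
  have := nacci_three c k hk
  rw [ckVal, ckVal, nacci_two c k hk]; linarith

theorem val3 (c k a b d : ℕ) (hk : 1 ≤ k) :
    ckVal c k a (b + (c + 1)) d = ckVal c k a b (d + 1) + ss c k := by
  have := nacci_four c k hk
  rw [ckVal, ckVal]; linarith

theorem rr_le (k : ℕ) : rr k ≤ 1 := by rw [rr]; split_ifs <;> omega

theorem rs_le (c k : ℕ) (hc : 1 ≤ c) : rr k + ss c k ≤ c + 1 := by
  rw [rr, ss]; split_ifs <;> omega

theorem u1 (c k n a b d : ℕ) (hk : 1 ≤ k) (h : ckVal c k (a + 1) b d ≤ n) :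
    CkMove c k (ckU c k n a b d) (ckU c k n (a + 1) b d) := by
  have e := val1 c k a b d hk
  have := ex1 c k (n - ckVal c k a b d) a b d (by omega)
  rw [show n - ckVal c k a b d - (c + 1) = n - ckVal c k (a + 1) b d by omega] at this
  exact this

theorem u2 (c k n a b d : ℕ) (hk : 1 ≤ k) (h : ckVal c k (a + (c + 1)) b d ≤ n) :
    CkMove c k (ckU c k n (a + (c + 1)) b d) (ckU c k n a (b + 1) d) := by
  have e := val2 c k a b d hk
  have := ex2 c k (n - ckVal c k (a + (c + 1)) b d) (a + (c + 1)) b d hk (by omega)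
  rw [show n - ckVal c k (a + (c + 1)) b d + rr k = n - ckVal c k a (b + 1) d by omega,
    Nat.add_sub_cancel] at this
  exact this

theorem u12 (c k n a b d : ℕ) (hk : 1 ≤ k) (h : ckVal c k a (b + 1) d ≤ n) :
    CkMove c k (ckU c k n (a + c) b d) (ckU c k n a (b + 1) d) := by
  have e := val2 c k a b d hk
  have e1 := val1 c k (a + c) b d hk
  rw [add_assoc] at e1
  have hr := rr_le k
  have := ex12 c k (n - ckVal c k (a + c) b d) (a + c) b d hk (by omega) (by omega)
  rw [show n - ckVal c k (a + c) b d - (c + 1 - rr k) = n - ckVal c k a (b + 1) d by omega,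
    Nat.add_sub_cancel] at this
  exact this

theorem u3 (c k n a b d : ℕ) (hk : 1 ≤ k) (h : ckVal c k a (b + (c + 1)) d ≤ n) :
    CkMove c k (ckU c k n a (b + (c + 1)) d) (ckU c k n a b (d + 1)) := by
  have e := val3 c k a b d hk
  have := ex3 c k (n - ckVal c k a (b + (c + 1)) d) a (b + (c + 1)) d hk (by omega)
  rw [show n - ckVal c k a (b + (c + 1)) d + ss c k = n - ckVal c k a b (d + 1) by omega,
    Nat.add_sub_cancel] at this
  exact this

theorem u123 (c k n a b d : ℕ) (hc : 1 ≤ c) (hk : 1 ≤ k) (h : ckVal c k a b (d + 1) ≤ n) :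
    CkMove c k (ckU c k n (a + c) (b + c) d) (ckU c k n a b (d + 1)) := by
  have e := val2 c k a (b + c) d hk
  have e1 := val1 c k (a + c) (b + c) d hk
  have e2 := val3 c k a b d hk
  rw [add_assoc] at e1 e
  have hr := rs_le c k hc
  have := ex123 c k (n - ckVal c k (a + c) (b + c) d) (a + c) (b + c) d hk (by omega)
    (by omega) (by omega)
  rw [show n - ckVal c k (a + c) (b + c) d - (c + 1 - rr k - ss c k)
    = n - ckVal c k a b (d + 1) by omega, Nat.add_sub_cancel, Nat.add_sub_cancel] at this
  exact this

theorem u_options (c k n a b d : ℕ) (hc : 1 ≤ c) (hk : 1 ≤ k) (B : Multiset ℕ)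
    (hab : a < c ∨ b < c) (hbd : b < c ∨ d < c) (hd : d ≤ c) (hac : a ≤ c)
    (hn : ckVal c k a b d ≤ n) (h : CkMove c k (ckU c k n a b d) B) :
    (B = ckU c k n (a + 1) b d) ∨ (a = c ∧ B = ckU c k n 0 (b + 1) d) ∨
    (c + 1 ≤ b ∧ B = ckU c k n a (b - (c + 1)) (d + 1)) := by
  rcases ckMove_options c k _ a b d hc hk B hab hbd hd h with ⟨h1, h2⟩ | ⟨h1, h2⟩ |
    ⟨h1, h3, h2⟩ | ⟨h1, h2⟩
  · left
    have e := val1 c k a b d hk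
    rw [h2, ckU]
    congr 1; omega
  · omega
  · have : a = c := by omega
    subst this
    right; left
    refine ⟨rfl, ?_⟩
    have e := val2 a k 0 b d hk
    have e1 := val1 a k a b d hk
    rw [zero_add] at e
    have hr := rr_le k
    rw [h2, ckU]
    congr 1 <;> omega
  · right; right
    refine ⟨h1, ?_⟩
    have e := val3 c k a (b - (c + 1)) d hk
    rw [show b - (c + 1) + (c + 1) = b by omega] at e
    rw [h2, ckU]
    congr 1; omega

theorem ck_start_win (c k n : ℕ) (hc : 1 ≤ c) (hk : 1 ≤ k)
    (hn : (c + 1) ^ 3 + (c + 1) ≤ n) (W : Multiset ℕ → Prop)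
    (hW : ∀ A, W A ↔ ∃ B, CkMove c k A B ∧ ¬ W B) :
    W (ckU c k n 0 0 0) ↔ Even c := by
  have e2 := nacci_two c k hk
  have e3 := nacci_three c k hk
  have e4 := nacci_four c k hk
  -- values
  have vmain : ckVal c k 1 (c + 1) 0 ≤ n := by
    rw [ckVal, e2]; nlinarith
  have vcc : ∀ a b, a ≤ c + 1 → b ≤ c → ckVal c k a b 0 ≤ n := by
    intro a b ha hb
    have h1 : a * (c + 1) ≤ (c + 1) * (c + 1) := Nat.mul_le_mul_right _ ha
    have h2 : b * nacci c k 3 ≤ c * nacci c k 3 := Nat.mul_le_mul_right _ hb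
    have h3 : c * nacci c k 3 ≤ c * ((c + 1) * (c + 1)) := Nat.mul_le_mul_left _ (by omega)
    rw [ckVal, e2]; nlinarith
  have v1 : ckVal c k 1 0 1 ≤ n := by
    have := val3 c k 1 0 0 hk
    rw [zero_add, zero_add] at this; omega
  have v0 : ckVal c k 0 0 1 ≤ n := by
    have := val1 c k 0 0 1 hk
    rw [zero_add] at this; omega
  have v2 : ckVal c k 0 (c + 1) 0 ≤ n := by
    have := val1 c k 0 (c + 1) 0 hk
    rw [zero_add] at this; omega
  -- forced moves
  have step : ∀ a b, a < c → b ≤ c → (W (ckU c k n (a + 1) b 0) ↔ ¬ W (ckU c k n a b 0)) := by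
    intro a b ha hb
    rw [hW (ckU c k n a b 0)]
    constructor
    · rintro h ⟨B, hB, hBW⟩
      rcases u_options c k n a b 0 hc hk B (Or.inl ha) (Or.inr (by omega)) (by omega) (by omega)
        (vcc a b (by omega) hb) hB with rfl | ⟨h1, _⟩ | ⟨h1, _⟩
      · exact hBW h
      · omega
      · omega
    · intro h
      by_contra hh
      exact h ⟨_, u1 c k n a b 0 hk (vcc _ _ (by omega) hb), hh⟩
  have row : ∀ b, b ≤ c → ∀ a, a ≤ c →
      (W (ckU c k n a b 0) ↔ (W (ckU c k n 0 b 0) ↔ Even a)) := by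
    intro b hb a
    induction a with
    | zero => intro _; simp
    | succ a ih =>
      intro ha
      rw [step a b (by omega) hb, ih (by omega), Nat.even_add_one]
      tauto
  have up : ∀ b, b < c → (W (ckU c k n 0 (b + 1) 0) ↔ ¬ W (ckU c k n c b 0)) := by
    intro b hb
    have hcb : W (ckU c k n (c + 1) b 0) := by
      have m1 := u2 c k n 0 b 0 hk (by rw [zero_add]; exact vcc _ _ le_rfl hb.le)
      rw [zero_add] at m1
      have m2 := u12 c k n 1 b 0 hk (vcc _ _ (by omega) (by omega))
      rw [add_comm 1 c] at m2
      have s := step 0 (b + 1) (by omega) (by omega)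
      rw [zero_add] at s
      rw [hW]
      by_cases h : W (ckU c k n 0 (b + 1) 0)
      · exact ⟨_, m2, fun h' => s.1 h' h⟩
      · exact ⟨_, m1, h⟩
    rw [hW (ckU c k n c b 0)]
    constructor
    · rintro h ⟨B, hB, hBW⟩
      rcases u_options c k n c b 0 hc hk B (Or.inr hb) (Or.inr (by omega)) (by omega) (by omega)
        (vcc c b (by omega) hb.le) hB with rfl | ⟨_, rfl⟩ | ⟨h1, _⟩
      · exact hBW hcb
      · exact hBW h
      · omega
    · intro h
      by_contra hh
      have m := u12 c k n 0 b 0 hk (vcc _ _ (by omega) (by omega))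
      rw [zero_add] at m
      exact h ⟨_, m, hh⟩
  have col : ∀ b, b ≤ c →
      (W (ckU c k n c b 0) ↔ (W (ckU c k n c 0 0) ↔ Even (b * (c + 1)))) := by
    intro b
    induction b with
    | zero => intro _; simp
    | succ b ih =>
      intro hb
      rw [row (b + 1) hb c le_rfl, up b (by omega), ih (by omega), Nat.succ_mul, Nat.even_add,
        Nat.even_add_one]
      tauto
  -- the key position
  have key : W (ckU c k n c c 0) := by
    by_contra hcon
    rw [hW] at hcon
    push Not at hcon
    have h1 : W (ckU c k n 0 0 1) := by
      have m := u123 c k n 0 0 0 hc hk v0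
      rw [zero_add, zero_add] at m
      exact hcon _ m
    have h2 : W (ckU c k n 0 (c + 1) 0) := by
      have m := u12 c k n 0 c 0 hk v2
      rw [zero_add] at m
      exact hcon _ m
    have h3 : ¬ W (ckU c k n 1 0 1) := by
      obtain ⟨B, hB, hBW⟩ := (hW _).1 h1
      rcases u_options c k n 0 0 1 hc hk B (Or.inl (by omega)) (Or.inl (by omega)) (by omega)
        (by omega) v0 hB with rfl | ⟨h, _⟩ | ⟨h, _⟩
      · exact hBW
      · omega
      · omega
    have h4 : ¬ W (ckU c k n 1 (c + 1) 0) := by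
      obtain ⟨B, hB, hBW⟩ := (hW _).1 h2
      rcases u_options c k n 0 (c + 1) 0 hc hk B (Or.inl (by omega)) (Or.inr (by omega))
        (by omega) (by omega) v2 hB with rfl | ⟨h, _⟩ | ⟨_, rfl⟩
      · exact hBW
      · omega
      · rw [Nat.sub_self] at hBW
        exact absurd h1 hBW
    apply h4
    rw [hW]
    have m := u3 c k n 1 0 0 hk (by rw [zero_add]; exact vmain)
    rw [zero_add] at m
    exact ⟨_, m, h3⟩
  have hev : Even (c * (c + 1)) := Nat.even_mul_succ_self c
  have hc0 := (col c le_rfl).1 key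
  have hr := row 0 (by omega) c le_rfl
  tauto

end NacciAux

/-- In the two-player `(c,k)`-nacci Zeckendorf game on `n`, for every `c ≥ 1`, every
`k ≥ 1`, and every `n ≥ (c+1)³ + (c+1)`: if `c` is odd then Player 2 has a winning
strategy, and if `c` is even then Player 1 has a winning strategy. -/
theorem two_player_ck_nacci_winner (c k n : ℕ) (hc : 1 ≤ c) (hk : 1 ≤ k)
    (hn : (c + 1) ^ 3 + (c + 1) ≤ n) :
    (Odd c → PlayerWins (CkMove c k) 2 2 n) ∧ (Even c → PlayerWins (CkMove c k) 2 1 n) := by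
  have hwf := ck_wf c k hc hk
  obtain ⟨W, hW⟩ := exists_win (CkMove c k) hwf
  have hstart : ckU c k n 0 0 0 = Multiset.replicate n 1 := by
    simp [ckU, ckPos, ckVal, nacci_at_one]
  have hs := ck_start_win c k n hc hk hn W hW
  rw [hstart] at hs
  constructor
  · intro hodd
    have hne : ¬ W (Multiset.replicate n 1) := by
      rw [hs]; exact Nat.not_even_iff_odd.2 hodd
    refine (win_alliance _ hwf W hW 2 (Or.inr rfl) _ 0).2 (by norm_num) hne ?_
    have hm := u1 c k n 0 0 0 hk (by
      have := nacci_two c k hk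
      simp only [ckVal, this]
      nlinarith [Nat.zero_le ((c + 1) ^ 3)])
    rw [hstart] at hm
    exact ⟨_, hm⟩
  · intro heven
    exact (win_alliance _ hwf W hW 1 (Or.inl rfl) _ 0).1 (by norm_num) (hs.2 heven)
end
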